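/- Let T : ℝ^d → ℝ^d be a C¹ diffeomorphism with inverse T⁻¹, and let ρ, p : ℝ^d → ℝ be strictly positive densities with ρ Lebesgue-integrable and (ln ρ − ln p)·ρ Lebesgue-integrable. Define the pushforward densities ρ_#(y) = ρ(T⁻¹(y)) |det D T⁻¹(y)| and p_#(y) = p(T⁻¹(y)) |det D T⁻¹(y)|, and the birth-death rate α(x; ρ, p) := ln ρ(x) − ln p(x) − (1/∫ρ) ∫ (ln ρ(x') − ln p(x')) ρ(x') dx'. Then for every y ∈ ℝ^d, α(y; ρ_#, p_#) = α(T⁻¹(y); ρ, p); that is, the pure birth-death rate is invariant under diffeomorphisms. -/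

import Mathlib

open MeasureTheory

/-- A differentiable map with a differentiable left inverse has nonvanishing Jacobian. -/
theorem det_fderiv_ne_zero_of_leftInverse {E : Type*} [NormedAddCommGroup E] [NormedSpace ℝ E]
    {f g : E → E} (hf : Differentiable ℝ f) (hg : Differentiable ℝ g)
    (h : Function.LeftInverse g f) (x : E) : (fderiv ℝ f x).det ≠ 0 := by
  have hcomp : (fderiv ℝ g (f x)).comp (fderiv ℝ f x) = ContinuousLinearMap.id ℝ E := by
    rw [← fderiv_comp x (hg (f x)) (hf x), h.comp_eq_id, fderiv_id]
  have hdet : (fderiv ℝ g (f x)).det * (fderiv ℝ f x).det = 1 := by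
    have := congrArg (fun A : E →L[ℝ] E => LinearMap.det (A : E →ₗ[ℝ] E)) hcomp
    simpa [ContinuousLinearMap.det] using this
  exact right_ne_zero_of_mul_eq_one hdet

/-- Change of variables for a differentiable bijection of the whole space. -/
theorem integral_comp_mul_abs_det_fderiv {E : Type*} [NormedAddCommGroup E] [NormedSpace ℝ E]
    [FiniteDimensional ℝ E] [MeasurableSpace E] [BorelSpace E] (μ : Measure E)
    [μ.IsAddHaarMeasure] {f : E → E} (hf : Differentiable ℝ f) (hbij : Function.Bijective f)
    (φ : E → ℝ) : ∫ x, φ (f x) * |(fderiv ℝ f x).det| ∂μ = ∫ x, φ x ∂μ := by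
  have h := integral_image_eq_integral_abs_det_fderiv_smul μ MeasurableSet.univ
    (fun x _ => (hf x).hasFDerivAt.hasFDerivWithinAt) hbij.injective.injOn φ
  rw [Set.image_univ, hbij.surjective.range_eq] at h
  simpa [mul_comm] using h.symm

/-- Diffeomorphic invariance of the pure birth-death rate: for a `C¹` diffeomorphism `T`
of `ℝ^d` with inverse `Tinv`, strictly positive densities `ρ` and `p` with the stated
integrability, and pushforward densities `ρ_#(y) = ρ(T⁻¹ y) |det D T⁻¹(y)|`,
`p_#(y) = p(T⁻¹ y) |det D T⁻¹(y)|`, the birth-death rate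
`α(x; ρ, p) = ln ρ(x) - ln p(x) - (∫ρ)⁻¹ ∫ (ln ρ - ln p) ρ` satisfies
`α(y; ρ_#, p_#) = α(T⁻¹(y); ρ, p)` for every `y`. -/
theorem birth_death_rate_diffeo_invariant (d : ℕ) (hd : 0 < d)
    (T Tinv : (Fin d → ℝ) → Fin d → ℝ)
    (hT : ContDiff ℝ 1 T) (hTinv : ContDiff ℝ 1 Tinv)
    (hleft : Function.LeftInverse Tinv T) (hright : Function.RightInverse Tinv T)
    (ρ p : (Fin d → ℝ) → ℝ) (hρpos : ∀ x, 0 < ρ x) (hppos : ∀ x, 0 < p x)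
    (hρint : Integrable ρ)
    (hlogint : Integrable fun x => (Real.log (ρ x) - Real.log (p x)) * ρ x)
    (ρpush ppush : (Fin d → ℝ) → ℝ)
    (hρpush : ∀ y, ρpush y = ρ (Tinv y) * |(fderiv ℝ Tinv y).det|)
    (hppush : ∀ y, ppush y = p (Tinv y) * |(fderiv ℝ Tinv y).det|)
    (α : ((Fin d → ℝ) → ℝ) → ((Fin d → ℝ) → ℝ) → (Fin d → ℝ) → ℝ)
    (hα : ∀ ρ' p' x, α ρ' p' x =
      Real.log (ρ' x) - Real.log (p' x) -
        (∫ x', ρ' x')⁻¹ * ∫ x', (Real.log (ρ' x') - Real.log (p' x')) * ρ' x') :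
    ∀ y : Fin d → ℝ, α ρpush ppush y = α ρ p (Tinv y) := by
  have hTd := hT.differentiable one_ne_zero
  have hTinvd := hTinv.differentiable one_ne_zero
  have hbij : Function.Bijective Tinv := ⟨hright.injective, hleft.surjective⟩
  have hlog : ∀ y, Real.log (ρpush y) - Real.log (ppush y) =
      Real.log (ρ (Tinv y)) - Real.log (p (Tinv y)) := fun y => by
    have hJ := abs_ne_zero.mpr (det_fderiv_ne_zero_of_leftInverse hTinvd hTd hright y)
    rw [hρpush, hppush, Real.log_mul (hρpos _).ne' hJ, Real.log_mul (hppos _).ne' hJ]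
    ring
  have hmass : ∫ y, ρpush y = ∫ x, ρ x := by
    simp_rw [hρpush]
    exact integral_comp_mul_abs_det_fderiv volume hTinvd hbij ρ
  have hmean : ∫ y, (Real.log (ρpush y) - Real.log (ppush y)) * ρpush y =
      ∫ x, (Real.log (ρ x) - Real.log (p x)) * ρ x := by
    simp_rw [hlog, hρpush, ← mul_assoc]
    exact integral_comp_mul_abs_det_fderiv volume hTinvd hbij
      fun x => (Real.log (ρ x) - Real.log (p x)) * ρ x
  intro y
  rw [hα, hα, hlog, hmass, hmean]
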